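/- arXiv:1405.6805 — 2 statements merged into one kernel-verified Lean document; each statement's English description precedes it below -/
import Mathlib

section
/- For each p ≥ 2, let P_p = N(0, I_p) be the standard Gaussian measure on ℝ^p and, for ν > 0, let Q_p(ν) = (1/p) Σ_{j=1}^p N(ν e_j, I_p) be the uniform mixture of Gaussians with mean ν in exactly one coordinate, where e_j is the j-th standard basis vector. If (ν_p) is a sequence of positive reals with √(2 log p) − ν_p → ∞ as p → ∞, then the total variation distance between Q_p(ν_p) and P_p converges to 0. -/
open MeasureTheory ProbabilityTheory Filter Real

/-- The Gaussian measure `N(m, I_p)` on `ℝ^p` with mean vector `m` and identity covariance,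
as the product of one-dimensional Gaussians. -/
noncomputable def gaussianPi (p : ℕ) (m : Fin p → ℝ) : Measure (Fin p → ℝ) :=
  Measure.pi fun j => gaussianReal (m j) 1

/-- The uniform mixture `Q_p(ν) = (1/p) ∑_{j=1}^p N(ν e_j, I_p)` of Gaussians with mean `ν`
in exactly one coordinate. -/
noncomputable def oneSpikeMixture (p : ℕ) (ν : ℝ) : Measure (Fin p → ℝ) :=
  (p : ENNReal)⁻¹ • ∑ j : Fin p, gaussianPi p (Pi.single j ν)

noncomputable def spikeL (ν x : ℝ) : ℝ := Real.exp (ν * x - ν ^ 2 / 2)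

lemma spikeL_meas (ν : ℝ) : Measurable (spikeL ν) := by
  unfold spikeL; fun_prop

lemma spikeL_pos (ν x : ℝ) : 0 < spikeL ν x := Real.exp_pos _

lemma gauss_eq (ν : ℝ) : gaussianReal ν 1
    = (gaussianReal 0 1).withDensity (fun x => ENNReal.ofReal (spikeL ν x)) := by
  rw [gaussianReal_of_var_ne_zero _ one_ne_zero, gaussianReal_of_var_ne_zero _ one_ne_zero,
    ← withDensity_mul _ (by fun_prop) ((spikeL_meas ν).ennreal_ofReal)]
  congr 1
  ext x
  simp only [Pi.mul_apply, gaussianPDF]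
  rw [← ENNReal.ofReal_mul (gaussianPDFReal_nonneg _ _ _)]
  congr 1
  simp only [gaussianPDFReal, spikeL]
  rw [mul_assoc (_ : ℝ)⁻¹, ← Real.exp_add]
  congr 2
  simp
  ring

lemma gaussPi_eq (p : ℕ) (ν : ℝ) (j : Fin p) : gaussianPi p (Pi.single j ν)
    = (gaussianPi p 0).withDensity (fun x => ENNReal.ofReal (spikeL ν (x j))) := by
  unfold gaussianPi
  apply Measure.pi_eq
  intro s hs
  rw [withDensity_apply _ (MeasurableSet.univ_pi hs), Measure.restrict_pi_pi]
  have h := lintegral_map (μ := Measure.pi fun i : Fin p =>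
    (gaussianReal ((0 : Fin p → ℝ) i) 1).restrict (s i))
    ((spikeL_meas ν).ennreal_ofReal) (measurable_pi_apply j)
  rw [← h]
  have h2 := Measure.pi_map_eval (μ := fun i : Fin p =>
    (gaussianReal ((0 : Fin p → ℝ) i) 1).restrict (s i)) j
  change Measure.map (fun a : Fin p → ℝ => a j) _ = _ at h2
  rw [h2, lintegral_smul_measure, ← Finset.mul_prod_erase _ _ (Finset.mem_univ j)]
  simp only [Pi.single_eq_same, Pi.zero_apply]
  rw [gauss_eq ν, withDensity_apply _ (hs j), mul_comm, smul_eq_mul]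
  congr 1
  apply Finset.prod_congr rfl
  intro i hi
  rw [Pi.single_eq_of_ne (Finset.ne_of_mem_erase hi)]
  simp

instance (p : ℕ) (m : Fin p → ℝ) : IsProbabilityMeasure (gaussianPi p m) := by
  unfold gaussianPi; infer_instance

lemma spikeL_integrable (ν : ℝ) : Integrable (spikeL ν) (gaussianReal 0 1) := by
  have := (integrable_exp_mul_gaussianReal (μ := 0) (v := 1) ν).mul_const (Real.exp (-(ν^2/2)))
  refine this.congr (ae_of_all _ fun x => ?_)
  simp only [spikeL]
  rw [← Real.exp_add]; congr 1

lemma spikeL_setInt (ν : ℝ) (s : Set ℝ) (hs : MeasurableSet s) :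
    ∫ x in s, spikeL ν x ∂(gaussianReal 0 1) = (gaussianReal ν 1).real s := by
  rw [gauss_eq ν, measureReal_def, withDensity_apply _ hs,
    ← ofReal_integral_eq_lintegral_ofReal (spikeL_integrable ν).integrableOn
      (ae_of_all _ fun x => (spikeL_pos ν x).le), ENNReal.toReal_ofReal]
  exact integral_nonneg fun x => (spikeL_pos ν x).le

lemma spikeL_int (ν : ℝ) : ∫ x, spikeL ν x ∂(gaussianReal 0 1) = 1 := by
  rw [← setIntegral_univ, spikeL_setInt ν _ MeasurableSet.univ]; simp

lemma gauss_shift (ν T : ℝ) : (gaussianReal ν 1).real (Set.Iic T)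
    = (gaussianReal 0 1).real (Set.Iic (T - ν)) := by
  have := gaussianReal_map_add_const (μ := 0) (v := 1) ν
  rw [zero_add] at this
  rw [← this, measureReal_def, Measure.map_apply (by fun_prop) measurableSet_Iic, measureReal_def]
  congr 2
  ext x
  simp [le_sub_iff_add_le]

lemma spikeL_int_pi (p : ℕ) (ν : ℝ) (j : Fin p) (f : ℝ → ℝ)
    (hf : AEStronglyMeasurable f (gaussianReal 0 1)) :
    ∫ x, f (x j) ∂(gaussianPi p 0) = ∫ x, f x ∂(gaussianReal 0 1) := by
  unfold gaussianPi
  exact integral_comp_eval (μ := fun i : Fin p => gaussianReal ((0 : Fin p → ℝ) i) 1) (i := j) hf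

lemma integrable_pi (p : ℕ) (j : Fin p) (f : ℝ → ℝ)
    (hf : Integrable f (gaussianReal 0 1)) :
    Integrable (fun x => f (x j)) (gaussianPi p 0) := by
  unfold gaussianPi
  exact integrable_comp_eval (μ := fun i : Fin p => gaussianReal ((0 : Fin p → ℝ) i) 1) (i := j) hf

/-- truncated likelihood ratio -/
noncomputable def truncL (ν T : ℝ) : ℝ → ℝ := (Set.Iic T).indicator (spikeL ν)

lemma truncL_meas (ν T : ℝ) : Measurable (truncL ν T) :=
  (spikeL_meas ν).indicator measurableSet_Iic

lemma truncL_integrable (ν T : ℝ) : Integrable (truncL ν T) (gaussianReal 0 1) :=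
  (spikeL_integrable ν).indicator measurableSet_Iic

lemma truncL_nonneg (ν T x : ℝ) : 0 ≤ truncL ν T x :=
  Set.indicator_nonneg (fun x _ => (spikeL_pos ν x).le) x

lemma truncL_le (ν T x : ℝ) : truncL ν T x ≤ spikeL ν x :=
  Set.indicator_le_self' (fun x _ => (spikeL_pos ν x).le) x

lemma truncL_le_bound (ν T x : ℝ) (hν : 0 < ν) : truncL ν T x ≤ spikeL ν T := by
  unfold truncL
  by_cases h : x ∈ Set.Iic T
  · rw [Set.indicator_of_mem h]
    have : x ≤ T := h
    unfold spikeL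
    gcongr
  · rw [Set.indicator_of_notMem h]
    exact (spikeL_pos ν T).le

lemma truncL_int (ν T : ℝ) : ∫ x, truncL ν T x ∂(gaussianReal 0 1)
    = (gaussianReal 0 1).real (Set.Iic (T - ν)) := by
  unfold truncL
  rw [integral_indicator measurableSet_Iic, spikeL_setInt ν _ measurableSet_Iic, gauss_shift]

lemma truncL_memLp (ν T : ℝ) (hν : 0 < ν) : MemLp (truncL ν T) 2 (gaussianReal 0 1) := by
  refine MemLp.of_bound (truncL_meas ν T).aestronglyMeasurable (spikeL ν T) (ae_of_all _ fun x => ?_)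
  rw [Real.norm_of_nonneg (truncL_nonneg ν T x)]
  exact truncL_le_bound ν T x hν

lemma truncL_var (ν T : ℝ) (hν : 0 < ν) :
    variance (truncL ν T) (gaussianReal 0 1) ≤ spikeL ν T := by
  refine (variance_le_expectation_sq (truncL_meas ν T).aestronglyMeasurable).trans ?_
  have : ∫ x, (truncL ν T ^ 2) x ∂(gaussianReal 0 1)
      ≤ ∫ x, spikeL ν T * spikeL ν x ∂(gaussianReal 0 1) := by
    refine integral_mono (truncL_memLp ν T hν).integrable_sq
      ((spikeL_integrable ν).const_mul _) fun x => ?_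
    simp only [sq]
    exact mul_le_mul (truncL_le_bound ν T x hν) (truncL_le ν T x) (truncL_nonneg ν T x)
      (spikeL_pos ν T).le
  rwa [integral_const_mul, spikeL_int, mul_one] at this

lemma abs_dev_le {Ω : Type*} [MeasurableSpace Ω] (P : Measure Ω) [IsProbabilityMeasure P]
    (X : Ω → ℝ) (hX : MemLp X 2 P) :
    ∫ x, |X x - ∫ y, X y ∂P| ∂P ≤ Real.sqrt (variance X P) := by
  apply Real.le_sqrt_of_sq_le
  have h1 : MemLp (fun x => |X x - ∫ y, X y ∂P|) 2 P := (hX.sub (memLp_const _)).abs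
  have h2 := variance_nonneg (fun x => |X x - ∫ y, X y ∂P|) P
  rw [variance_eq_sub h1] at h2
  rw [variance_eq_integral hX.aemeasurable]
  simp only [Pi.pow_apply, sq_abs] at h2
  linarith

lemma dev_bound (p : ℕ) (ν T : ℝ) (hν : 0 < ν) :
    ∫ x, |∑ j, truncL ν T (x j) - p * (gaussianReal 0 1).real (Set.Iic (T - ν))| ∂(gaussianPi p 0)
      ≤ Real.sqrt (p * spikeL ν T) := by
  have hm : ∀ j : Fin p, MemLp (fun x : Fin p → ℝ => truncL ν T (x j)) 2 (gaussianPi p 0) := by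
    intro j
    unfold gaussianPi
    exact (truncL_memLp ν T hν).comp_measurePreserving
      (measurePreserving_eval (fun i : Fin p => gaussianReal ((0 : Fin p → ℝ) i) 1) j)
  have h := abs_dev_le (gaussianPi p 0) (∑ j, fun x : Fin p → ℝ => truncL ν T (x j))
    (memLp_finsetSum' _ fun j _ => hm j)
  have hi : ∫ y, (∑ j, fun x : Fin p → ℝ => truncL ν T (x j)) y ∂(gaussianPi p 0)
      = p * (gaussianReal 0 1).real (Set.Iic (T - ν)) := by
    simp only [Finset.sum_apply]
    rw [integral_finsetSum _ fun j _ => integrable_pi p j _ (truncL_integrable ν T)]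
    simp [spikeL_int_pi p ν _ _ (truncL_meas ν T).aestronglyMeasurable, truncL_int]
  rw [hi] at h
  simp only [Finset.sum_apply] at h
  refine h.trans (Real.sqrt_le_sqrt ?_)
  unfold gaussianPi
  rw [variance_sum_pi (μ := fun i : Fin p => gaussianReal ((0 : Fin p → ℝ) i) 1)
    (X := fun _ => truncL ν T) fun _ => truncL_memLp ν T hν]
  refine (Finset.sum_le_card_nsmul _ _ (spikeL ν T) fun i _ => truncL_var ν T hν).trans ?_
  simp

lemma tv_bound (p : ℕ) (hp : 0 < p) (ν T : ℝ) (hν : 0 < ν) (A : Set (Fin p → ℝ))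
    (hA : MeasurableSet A) :
    |(oneSpikeMixture p ν A).toReal - (gaussianPi p 0 A).toReal|
      ≤ Real.sqrt (p * spikeL ν T) / p + 2 * (1 - (gaussianReal 0 1).real (Set.Iic (T - ν))) := by
  set m := (gaussianReal 0 1).real (Set.Iic (T - ν)) with hmdef
  have hm1 : m ≤ 1 := measureReal_le_one
  have hp' : (0 : ℝ) < p := by exact_mod_cast hp
  set P := gaussianPi p 0 with hP
  have hIL : ∀ j : Fin p, Integrable (fun x => spikeL ν (x j)) P :=
    fun j => integrable_pi p j _ (spikeL_integrable ν)
  have hIT : ∀ j : Fin p, Integrable (fun x => truncL ν T (x j)) P :=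
    fun j => integrable_pi p j _ (truncL_integrable ν T)
  have hQ : (oneSpikeMixture p ν A).toReal = (p : ℝ)⁻¹ * ∫ x in A, ∑ j, spikeL ν (x j) ∂P := by
    unfold oneSpikeMixture
    rw [Measure.smul_apply, Measure.finsetSum_apply, smul_eq_mul, ENNReal.toReal_mul,
      ENNReal.toReal_sum (fun j _ => measure_ne_top _ _),
      integral_finsetSum _ fun j _ => (hIL j).integrableOn]
    simp only [ENNReal.toReal_inv, ENNReal.toReal_natCast]
    congr 1
    refine Finset.sum_congr rfl fun j _ => ?_
    rw [gaussPi_eq, withDensity_apply _ hA,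
      ← ofReal_integral_eq_lintegral_ofReal (hIL j).integrableOn
        (ae_of_all _ fun x => (spikeL_pos ν _).le), ENNReal.toReal_ofReal]
    exact integral_nonneg fun x => (spikeL_pos ν _).le
  have hPA : (P A).toReal = (p : ℝ)⁻¹ * ∫ x in A, (p : ℝ) ∂P := by
    rw [setIntegral_const, measureReal_def, smul_eq_mul]
    field_simp
  have hS : Integrable (fun x : Fin p → ℝ => ∑ j, spikeL ν (x j)) P :=
    integrable_finsetSum _ fun j _ => hIL j
  have hS' : Integrable (fun x : Fin p → ℝ => ∑ j, truncL ν T (x j)) P :=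
    integrable_finsetSum _ fun j _ => hIT j
  have hD : Integrable (fun x : Fin p → ℝ => |∑ j, truncL ν T (x j) - p * m|) P :=
    (hS'.sub (integrable_const _)).abs
  rw [hQ, hPA, ← mul_sub, ← integral_sub hS.integrableOn (integrable_const _), abs_mul,
    abs_of_pos (inv_pos.2 hp')]
  have key : |∫ x in A, (∑ j, spikeL ν (x j) - (p : ℝ)) ∂P|
      ≤ Real.sqrt (p * spikeL ν T) + 2 * (p * (1 - m)) := by
    calc _ ≤ ∫ x in A, |∑ j, spikeL ν (x j) - (p : ℝ)| ∂P := abs_integral_le_integral_abs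
      _ ≤ ∫ x, |∑ j, spikeL ν (x j) - (p : ℝ)| ∂P :=
        setIntegral_le_integral (hS.sub (integrable_const _)).abs
          (ae_of_all _ fun x => abs_nonneg _)
      _ ≤ ∫ x, (|∑ j, truncL ν T (x j) - p * m|
            + ((∑ j, spikeL ν (x j) - ∑ j, truncL ν T (x j)) + p * (1 - m))) ∂P := by
        refine integral_mono (hS.sub (integrable_const _)).abs
          (hD.add ((hS.sub hS').add (integrable_const _))) fun x => ?_
        have h1 : ∑ j, truncL ν T (x j) ≤ ∑ j, spikeL ν (x j) :=
          Finset.sum_le_sum fun j _ => truncL_le _ _ _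
        have h2 : 0 ≤ p * (1 - m) := mul_nonneg hp'.le (by linarith)
        have h3 := neg_abs_le (∑ j, truncL ν T (x j) - p * m)
        have h4 := le_abs_self (∑ j, truncL ν T (x j) - p * m)
        simp only
        rw [abs_le]
        constructor <;> linarith
      _ = ∫ x, |∑ j, truncL ν T (x j) - p * m| ∂P + ((p - p * m) + p * (1 - m)) := by
        have hE : Integrable (fun x : Fin p → ℝ => (∑ j, spikeL ν (x j) - ∑ j, truncL ν T (x j)) + p * (1 - m)) P :=
          (hS.sub hS').add (integrable_const _)
        have hF : Integrable (fun x : Fin p → ℝ => ∑ j, spikeL ν (x j) - ∑ j, truncL ν T (x j)) P :=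
          hS.sub hS'
        rw [integral_add hD hE,
          integral_add hF (integrable_const _), integral_sub hS hS',
          integral_finsetSum _ fun j _ => hIL j, integral_finsetSum _ fun j _ => hIT j]
        simp [hP, hmdef, spikeL_int_pi p ν _ _ (truncL_meas ν T).aestronglyMeasurable, truncL_int,
          spikeL_int_pi p ν _ _ (spikeL_meas ν).aestronglyMeasurable, spikeL_int]
      _ ≤ _ := by
        have := dev_bound p ν T hν
        linarith
  calc _ ≤ (p : ℝ)⁻¹ * (Real.sqrt (p * spikeL ν T) + 2 * (p * (1 - m))) := by gcongr
    _ = _ := by field_simp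

lemma sqrt_eq (p : ℕ) (hp : 0 < p) (ν : ℝ) :
    Real.sqrt (p * spikeL ν (Real.sqrt (2 * Real.log p))) / p
      = Real.exp (-(Real.sqrt (2 * Real.log p) - ν) ^ 2 / 4) := by
  have hp' : (0 : ℝ) < p := by exact_mod_cast hp
  have hT : Real.sqrt (2 * Real.log p) ^ 2 = 2 * Real.log p :=
    Real.sq_sqrt (mul_nonneg zero_le_two (Real.log_natCast_nonneg p))
  set T := Real.sqrt (2 * Real.log p)
  have hpe : (p : ℝ) = Real.exp (T ^ 2 / 2) := by
    rw [hT, mul_div_cancel_left₀ _ two_ne_zero, Real.exp_log hp']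
  rw [hpe, spikeL, ← Real.exp_add, Real.sqrt_eq_rpow, ← Real.exp_mul, ← Real.exp_sub]
  congr 1
  ring

/-- If `√(2 log p) − ν_p → ∞`, then the total variation distance between the one-spike
mixture `Q_p(ν_p)` and the standard Gaussian `P_p = N(0, I_p)` converges to `0`. -/
theorem stmt10 (ν : ℕ → ℝ) (hν : ∀ p, 0 < ν p)
    (hgap : Tendsto (fun p : ℕ => Real.sqrt (2 * Real.log p) - ν p) atTop atTop) :
    Tendsto
      (fun p : ℕ =>
        ⨆ A : {s : Set (Fin p → ℝ) // MeasurableSet s},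
          |(oneSpikeMixture p (ν p) A.1).toReal - (gaussianPi p 0 A.1).toReal|)
      atTop (nhds 0) := by
  have hlim : Tendsto (fun p : ℕ => Real.exp (-(Real.sqrt (2 * Real.log p) - ν p) ^ 2 / 4)
      + 2 * (1 - cdf (gaussianReal 0 1) (Real.sqrt (2 * Real.log p) - ν p))) atTop (nhds 0) := by
    have h1 : Tendsto (fun a : ℝ => Real.exp (-a ^ 2 / 4)) atTop (nhds 0) := by
      refine Real.tendsto_exp_atBot.comp ?_
      refine Tendsto.atBot_div_const (by norm_num) ?_
      exact tendsto_neg_atTop_atBot.comp (tendsto_pow_atTop two_ne_zero)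
    have h2 : Tendsto (fun a : ℝ => 2 * (1 - cdf (gaussianReal 0 1) a)) atTop (nhds 0) := by
      simpa using ((tendsto_cdf_atTop (gaussianReal 0 1)).const_sub 1).const_mul 2
    have h3 := (h1.add h2).comp hgap
    rw [add_zero] at h3
    exact h3
  refine squeeze_zero' (Eventually.of_forall fun p => Real.iSup_nonneg fun A => abs_nonneg _) ?_ hlim
  filter_upwards [eventually_gt_atTop 0] with p hp
  haveI : Nonempty {s : Set (Fin p → ℝ) // MeasurableSet s} := ⟨⟨∅, MeasurableSet.empty⟩⟩
  refine ciSup_le fun A => ?_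
  have := tv_bound p hp (ν p) (Real.sqrt (2 * Real.log p)) (hν p) A.1 A.2
  rwa [sqrt_eq p hp, ← cdf_eq_real] at this
end

section
/- For each p ≥ 2, let 𝒯_p denote the class of measurable tests T : ℝ^p → [0,1] that are permutation invariant, i.e., T(x_{σ(1)}, …, x_{σ(p)}) = T(x_1, …, x_p) for every permutation σ of {1, …, p} and every x ∈ ℝ^p. For β ∈ ℝ^p define Power(T, β) = ∫ T dN(β, I_p) and Level(T) = ∫ T dN(0, I_p), and let B_p(ν) be the set of vectors β ∈ ℝ^p with exactly one nonzero entry, that entry having absolute value at most ν. If (ν_p) is a sequence of positive reals with √(2 log p) − ν_p → ∞ as p → ∞, then sup_{T ∈ 𝒯_p, β ∈ B_p(ν_p)} |Power(T, β) − Level(T)| → 0 as p → ∞. -/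
open MeasureTheory ProbabilityTheory Filter Real

/-- A measurable, `[0,1]`-valued, permutation-invariant test on `ℝ^p`. -/
def IsPermInvariantTest (p : ℕ) (T : (Fin p → ℝ) → ℝ) : Prop :=
  Measurable T ∧ (∀ x, T x ∈ Set.Icc (0 : ℝ) 1) ∧
    ∀ σ : Equiv.Perm (Fin p), ∀ x : Fin p → ℝ, T (fun i => x (σ i)) = T x

/-- `B_p(ν)`: vectors of `ℝ^p` with exactly one nonzero entry, of absolute value at most `ν`. -/
def oneSpikeSet (p : ℕ) (ν : ℝ) : Set (Fin p → ℝ) :=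
  {β | ∃ j, β j ≠ 0 ∧ |β j| ≤ ν ∧ ∀ k, k ≠ j → β k = 0}


noncomputable def lik (b x : ℝ) : ℝ := Real.exp (b * x - b ^ 2 / 2)

lemma lik_meas (b : ℝ) : Measurable (lik b) := by
  unfold lik; fun_prop

lemma lik_pos (b x : ℝ) : 0 < lik b x := Real.exp_pos _

lemma gauss_shift_s11 (b : ℝ) : gaussianReal b 1 =
    (gaussianReal 0 1).withDensity (fun x => ENNReal.ofReal (lik b x)) := by
  rw [gaussianReal_of_var_ne_zero _ one_ne_zero, gaussianReal_of_var_ne_zero _ one_ne_zero,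
    ← withDensity_mul _ (measurable_gaussianPDF 0 1) (lik_meas b).ennreal_ofReal]
  congr 1
  ext x
  simp only [Pi.mul_apply, gaussianPDF]
  rw [← ENNReal.ofReal_mul (gaussianPDFReal_nonneg _ _ _)]
  congr 1
  simp only [gaussianPDFReal, lik]
  rw [mul_assoc _ (Real.exp _), ← Real.exp_add]
  congr 2
  simp
  ring

lemma gaussPi_shift (p : ℕ) (β : Fin p → ℝ) : gaussianPi p β =
    (gaussianPi p 0).withDensity (fun x => ∏ i, ENNReal.ofReal (lik (β i) (x i))) := by
  unfold gaussianPi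
  refine Measure.pi_eq (fun s hs => ?_)
  rw [withDensity_apply _ (MeasurableSet.univ_pi hs), ← lintegral_indicator (MeasurableSet.univ_pi hs)]
  have h1 : ∀ i, Measurable
      ((s i).indicator (fun y => ENNReal.ofReal (lik (β i) y))) := fun i =>
    (lik_meas (β i)).ennreal_ofReal.indicator (hs i)
  have : ∀ x : Fin p → ℝ, (Set.univ.pi s).indicator
      (fun x => ∏ i, ENNReal.ofReal (lik (β i) (x i))) x =
      ∏ i, (s i).indicator (fun y => ENNReal.ofReal (lik (β i) y)) (x i) := by
    intro x
    by_cases hx : x ∈ Set.univ.pi s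
    · rw [Set.indicator_of_mem hx]
      refine Finset.prod_congr rfl fun i _ => ?_
      rw [Set.indicator_of_mem (hx i (Set.mem_univ i))]
    · rw [Set.indicator_of_notMem hx]
      simp only [Set.mem_pi, Set.mem_univ, true_imp_iff, not_forall] at hx
      obtain ⟨i, hi⟩ := hx
      symm
      exact Finset.prod_eq_zero (Finset.mem_univ i) (Set.indicator_of_notMem hi _)
  simp_rw [this]
  rw [lintegral_prod_eq_prod_lintegral_of_indepFun Finset.univ
    (fun i (x : Fin p → ℝ) => (s i).indicator (fun y => ENNReal.ofReal (lik (β i) y)) (x i))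
    (iIndepFun_pi (μ := fun j => gaussianReal ((0 : Fin p → ℝ) j) 1)
      (fun i => (h1 i).aemeasurable)) (fun i => (h1 i).comp (measurable_pi_apply i))]
  refine Finset.prod_congr rfl fun i _ => ?_
  rw [(measurePreserving_eval (fun j => gaussianReal ((0 : Fin p → ℝ) j) 1) i).lintegral_comp (h1 i),
    lintegral_indicator (hs i), gauss_shift_s11 (β i), withDensity_apply _ (hs i)]
  rfl

lemma power_eq (p : ℕ) (β : Fin p → ℝ) (j : Fin p) (hj : ∀ k, k ≠ j → β k = 0)
    (T : (Fin p → ℝ) → ℝ) :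
    ∫ x, T x ∂(gaussianPi p β) = ∫ x, lik (β j) (x j) * T x ∂(gaussianPi p 0) := by
  have hm : Measurable (fun x : Fin p → ℝ => ENNReal.ofReal (lik (β j) (x j))) :=
    ((lik_meas _).comp (measurable_pi_apply j)).ennreal_ofReal
  have : (fun x : Fin p → ℝ => ∏ i, ENNReal.ofReal (lik (β i) (x i))) =
      fun x => ENNReal.ofReal (lik (β j) (x j)) := by
    ext x
    refine Finset.prod_eq_single j (fun i _ hi => ?_) (by simp)
    simp [hj i hi, lik]
  rw [gaussPi_shift, this, integral_withDensity_eq_integral_toReal_smul hm (by simp)]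
  refine integral_congr_ae (ae_of_all _ fun x => ?_)
  simp [ENNReal.toReal_ofReal (lik_pos _ _).le]

lemma swap_eq (p : ℕ) (b : ℝ) (j k : Fin p) (T : (Fin p → ℝ) → ℝ)
    (hT : IsPermInvariantTest p T) :
    ∫ x, lik b (x k) * T x ∂(gaussianPi p 0) = ∫ x, lik b (x j) * T x ∂(gaussianPi p 0) := by
  have h := measurePreserving_piCongrLeft (fun _ : Fin p => gaussianReal 0 1) (Equiv.swap j k)
  have h2 := h.integral_comp' (fun x => lik b (x k) * T x)
  have e : gaussianPi p 0 = Measure.pi (fun _ : Fin p => gaussianReal 0 1) := rfl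
  rw [e, ← h2]
  refine integral_congr_ae (ae_of_all _ fun x => ?_)
  have h3 : ∀ i, (MeasurableEquiv.piCongrLeft (fun _ : Fin p => ℝ) (Equiv.swap j k)) x i =
      x (Equiv.swap j k i) := by
    intro i
    have := MeasurableEquiv.piCongrLeft_apply_apply (β := fun _ : Fin p => ℝ) (Equiv.swap j k) x
      (Equiv.swap j k i)
    simpa using this
  have h4 : (MeasurableEquiv.piCongrLeft (fun _ : Fin p => ℝ) (Equiv.swap j k)) x =
      fun i => x (Equiv.swap j k i) := funext h3
  simp only [h4, hT.2.2, Equiv.swap_apply_right]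

lemma exp_int (a c : ℝ) : Integrable (fun x => Real.exp (a * x + c)) (gaussianReal 0 1) := by
  simp_rw [Real.exp_add]
  exact (integrable_exp_mul_gaussianReal a).mul_const _

lemma exp_integral (a c : ℝ) :
    ∫ x, Real.exp (a * x + c) ∂(gaussianReal 0 1) = Real.exp (a ^ 2 / 2 + c) := by
  simp_rw [Real.exp_add]
  rw [integral_mul_const]
  have := congrFun (mgf_id_gaussianReal (μ := 0) (v := 1)) a
  simp only [mgf, id] at this
  rw [this]
  simp

lemma trunc (b t ν : ℝ) (hb : |b| ≤ ν) (ht : ν ≤ t) : ∃ f : ℝ → ℝ, Measurable f ∧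
    (∀ x, 0 ≤ f x) ∧ (∀ x, f x ≤ lik b x) ∧
    ∫ x, f x ^ 2 ∂(gaussianReal 0 1) ≤ Real.exp (t ^ 2 / 2) * Real.exp (-(t - ν) ^ 2 / 4) ∧
    ∫ x, (lik b x - f x) ∂(gaussianReal 0 1) ≤ Real.exp (-(t - ν) ^ 2 / 2) := by
  obtain ⟨s, hs, hsb⟩ : ∃ s : ℝ, s ^ 2 = 1 ∧ b = s * |b| := by
    rcases le_total 0 b with h | h
    · exact ⟨1, by norm_num, by rw [abs_of_nonneg h]; ring⟩
    · exact ⟨-1, by norm_num, by rw [abs_of_nonpos h]; ring⟩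
  have hc0 := abs_nonneg b
  generalize |b| = c at *
  have hS : MeasurableSet {x : ℝ | s * x ≤ t} :=
    measurableSet_le (by fun_prop) (by fun_prop)
  have hg : (t - ν) ^ 2 ≤ (t - c) ^ 2 := by nlinarith
  refine ⟨{x : ℝ | s * x ≤ t}.indicator (lik b), (lik_meas b).indicator hS,
    fun x => Set.indicator_nonneg (fun _ _ => (lik_pos _ _).le) x,
    fun x => Set.indicator_le_self' (fun _ _ => (lik_pos _ _).le) x, ?_, ?_⟩
  · -- second moment
    have key : ∀ l : ℝ, 0 ≤ l →
        ∫ x, ({x : ℝ | s * x ≤ t}.indicator (lik b) x) ^ 2 ∂(gaussianReal 0 1) ≤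
        Real.exp ((2 * c - l) ^ 2 / 2 + (l * t - c ^ 2)) := by
      intro l hl
      have h1 := exp_integral ((2 * c - l) * s) (l * t - c ^ 2)
      rw [mul_pow, hs, mul_one] at h1
      rw [← h1]
      refine integral_mono_of_nonneg (ae_of_all _ fun x => sq_nonneg _) (exp_int _ _)
        (ae_of_all _ fun x => ?_)
      by_cases hx : s * x ≤ t
      · simp only
        rw [Set.indicator_of_mem (show x ∈ {x : ℝ | s * x ≤ t} from hx), lik, ← Real.exp_nat_mul]
        refine Real.exp_le_exp.2 ?_
        have : b ^ 2 = c ^ 2 := by rw [hsb, mul_pow, hs, one_mul]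
        rw [this, hsb]
        push_cast
        nlinarith
      · simp only
        rw [Set.indicator_of_notMem (show x ∉ {x : ℝ | s * x ≤ t} from hx)]
        simpa using (Real.exp_pos _).le
    rw [← Real.exp_add]
    rcases le_total (2 * c) t with h | h
    · refine (key 0 le_rfl).trans (Real.exp_le_exp.2 ?_)
      nlinarith
    · refine (key (2 * c - t) (by linarith)).trans (Real.exp_le_exp.2 ?_)
      nlinarith [sq_nonneg (t - ν)]
  · have h1 := exp_integral (t * s) (- c ^ 2 / 2 - (t - c) * t)
    rw [mul_pow, hs, mul_one] at h1
    have h2 : Real.exp (t ^ 2 / 2 + (- c ^ 2 / 2 - (t - c) * t)) ≤ Real.exp (-(t - ν) ^ 2 / 2) :=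
      Real.exp_le_exp.2 (by nlinarith)
    refine le_trans ?_ h2
    rw [← h1]
    refine integral_mono_of_nonneg (ae_of_all _ fun x => ?_) (exp_int _ _)
        (ae_of_all _ fun x => ?_)
    · exact sub_nonneg.2 (Set.indicator_le_self' (fun _ _ => (lik_pos _ _).le) x)
    · by_cases hx : s * x ≤ t
      · simp only
        rw [Set.indicator_of_mem (show x ∈ {x : ℝ | s * x ≤ t} from hx), sub_self]
        exact (Real.exp_pos _).le
      · simp only
        rw [Set.indicator_of_notMem (show x ∉ {x : ℝ | s * x ≤ t} from hx), sub_zero, lik]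
        refine Real.exp_le_exp.2 ?_
        have : b ^ 2 = c ^ 2 := by rw [hsb, mul_pow, hs, one_mul]
        rw [this, hsb]
        push Not at hx
        nlinarith

lemma lik_int (b : ℝ) : Integrable (lik b) (gaussianReal 0 1) := by
  have := exp_int b (-b ^ 2 / 2)
  refine this.congr (ae_of_all _ fun x => ?_)
  simp only [lik]
  ring_nf

lemma lik_integral (b : ℝ) : ∫ x, lik b x ∂(gaussianReal 0 1) = 1 := by
  have := exp_integral b (-b ^ 2 / 2)
  rw [show b ^ 2 / 2 + -b ^ 2 / 2 = 0 by ring, Real.exp_zero] at this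
  rw [← this]
  refine integral_congr_ae (ae_of_all _ fun x => ?_)
  simp only [lik]
  ring_nf

lemma lik_memLp (b : ℝ) : MemLp (lik b) 2 (gaussianReal 0 1) := by
  rw [memLp_two_iff_integrable_sq (lik_meas b).aestronglyMeasurable]
  refine (exp_int (2 * b) (-b ^ 2)).congr (ae_of_all _ fun x => ?_)
  simp only [lik]
  rw [← Real.exp_nat_mul]
  push_cast
  ring_nf

lemma main_bound (p : ℕ) (hp : 0 < p) (ν : ℝ) (hν : ν ≤ Real.sqrt (2 * Real.log p))
    (T : (Fin p → ℝ) → ℝ) (hT : IsPermInvariantTest p T) (β : Fin p → ℝ)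
    (hβ : β ∈ oneSpikeSet p ν) :
    |(∫ x, T x ∂(gaussianPi p β)) - ∫ x, T x ∂(gaussianPi p 0)| ≤
      Real.exp (-(Real.sqrt (2 * Real.log p) - ν) ^ 2 / 8) +
        2 * Real.exp (-(Real.sqrt (2 * Real.log p) - ν) ^ 2 / 2) := by
  obtain ⟨j, -, hb, hj⟩ := hβ
  rw [power_eq p β j hj T]
  generalize β j = b at hb
  clear hj β
  have hp1 : (1 : ℝ) ≤ p := by exact_mod_cast hp
  have hp0 : (0 : ℝ) < p := by linarith
  have het : Real.exp (Real.sqrt (2 * Real.log p) ^ 2 / 2) = p := by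
    rw [Real.sq_sqrt (by have := Real.log_nonneg hp1; linarith)]
    rw [show 2 * Real.log p / 2 = Real.log p by ring, Real.exp_log hp0]
  generalize Real.sqrt (2 * Real.log p) = t at *
  obtain ⟨f, hfm, hf0, hfL, hf2, hfe⟩ := trunc b t ν hb hν
  rw [het] at hf2
  have hδ2 : Real.exp (-(t - ν) ^ 2 / 4) = Real.exp (-(t - ν) ^ 2 / 8) ^ 2 := by
    rw [← Real.exp_nat_mul]; push_cast; ring_nf
  rw [hδ2] at hf2
  have hδ : 0 < Real.exp (-(t - ν) ^ 2 / 8) := Real.exp_pos _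
  generalize Real.exp (-(t - ν) ^ 2 / 8) = δ at *
  generalize Real.exp (-(t - ν) ^ 2 / 2) = ε at *
  set g : Measure ℝ := gaussianReal 0 1 with hg
  have eγ : gaussianPi p 0 = Measure.pi (fun _ : Fin p => g) := rfl
  have hfLp : MemLp f 2 g := (lik_memLp b).mono hfm.aestronglyMeasurable
    (ae_of_all _ fun x => by
      rw [Real.norm_of_nonneg (hf0 x), Real.norm_of_nonneg (lik_pos b x).le]; exact hfL x)
  have hfi : Integrable f g := hfLp.integrable (by norm_num)
  have hLi : Integrable (lik b) g := lik_int b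
  set m := ∫ x, f x ∂g with hm
  have hm1 : 1 - m ≤ ε := by
    rw [integral_sub hLi hfi, lik_integral] at hfe
    exact hfe
  have hm0 : 0 ≤ 1 - m := by
    rw [← lik_integral b, hm, ← integral_sub hLi hfi]
    exact integral_nonneg fun x => sub_nonneg.2 (hfL x)
  set γ : Measure (Fin p → ℝ) := Measure.pi (fun _ : Fin p => g) with hγ
  -- the variance part
  set S : (Fin p → ℝ) → ℝ := ∑ i : Fin p, fun x => f (x i) with hS
  have hSx : ∀ x, S x = ∑ i, f (x i) := fun x => by simp [hS]
  have hSLp : MemLp S 2 γ := memLp_finsetSum' _ fun i _ =>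
    hfLp.comp_measurePreserving (measurePreserving_eval (fun _ : Fin p => g) i)
  have hSmean : ∫ x, S x ∂γ = p * m := by
    simp_rw [hSx]
    have hd : ∀ i : Fin p, Integrable (fun x : Fin p → ℝ => f (x i)) γ :=
      fun i => integrable_comp_eval (μ := fun _ : Fin p => g) hfi
    rw [integral_finsetSum _ (fun i _ => hd i)]
    have : ∀ i : Fin p, ∫ x : Fin p → ℝ, f (x i) ∂γ = m := fun i =>
      integral_comp_eval (μ := fun _ : Fin p => g) (f := f) hfi.aestronglyMeasurable
    simp_rw [this]
    simp
  have hvar : ∫ x, (S x - p * m) ^ 2 ∂γ ≤ p * (p * δ ^ 2) := by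
    rw [← hSmean, ← variance_eq_integral hSLp.aemeasurable, hγ, hS,
      variance_sum_pi (X := fun _ : Fin p => f) (μ := fun _ : Fin p => g) (fun _ => hfLp)]
    have : Var[f; g] ≤ p * δ ^ 2 :=
      (variance_le_expectation_sq hfm.aestronglyMeasurable).trans hf2
    simpa using mul_le_mul_of_nonneg_left this hp0.le
  have hsqi : Integrable (fun x => (S x - p * m) ^ 2) γ :=
    (hSLp.sub (memLp_const _)).integrable_sq
  have hri : ∀ i : Fin p, Integrable (fun x : Fin p → ℝ => lik b (x i) - f (x i)) γ := fun i =>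
    integrable_comp_eval (μ := fun _ : Fin p => g) (f := fun y => lik b y - f y) (hLi.sub hfi)
  have hTi : Integrable T γ := by
    refine Integrable.of_bound hT.1.aestronglyMeasurable 1 (ae_of_all _ fun x => ?_)
    rw [Real.norm_of_nonneg (hT.2.1 x).1]; exact (hT.2.1 x).2
  have hLTi : ∀ i : Fin p, Integrable (fun x => lik b (x i) * T x) γ := fun i => by
    refine Integrable.mul_bdd (c := 1)
      (integrable_comp_eval (μ := fun _ : Fin p => g) hLi) hT.1.aestronglyMeasurable
      (ae_of_all _ fun x => ?_)
    rw [Real.norm_of_nonneg (hT.2.1 x).1]; exact (hT.2.1 x).2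
  have hmain : (p : ℝ) * ((∫ x, lik b (x j) * T x ∂γ) - ∫ x, T x ∂γ) =
      ∫ x, (∑ i, (lik b (x i) * T x - T x)) ∂γ := by
    have hd : ∀ i : Fin p, Integrable (fun x => lik b (x i) * T x - T x) γ :=
      fun i => (hLTi i).sub hTi
    rw [integral_finsetSum _ (fun i _ => hd i)]
    have : ∀ i, ∫ x, (lik b (x i) * T x - T x) ∂γ =
        (∫ x, lik b (x j) * T x ∂γ) - ∫ x, T x ∂γ := fun i => by
      rw [integral_sub (hLTi i) hTi]
      have := swap_eq p b j i T hT
      rw [eγ] at this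
      rw [this]
    simp_rw [this]
    simp [mul_sub]
  set G : (Fin p → ℝ) → ℝ := fun x => (S x - p * m) ^ 2 / (2 * p * δ) +
    ∑ i, (lik b (x i) - f (x i)) + (p * δ / 2 + p * (1 - m)) with hG
  have hi1 : Integrable (fun x => (S x - p * m) ^ 2 / (2 * p * δ)) γ := hsqi.div_const _
  have hi2 : Integrable (fun x : Fin p → ℝ => ∑ i, (lik b (x i) - f (x i))) γ :=
    integrable_finsetSum _ fun i _ => hri i
  have hGi : Integrable G γ := (hi1.add hi2).add (integrable_const _)
  have hGint : ∫ x, G x ∂γ ≤ p * (δ + 2 * ε) := by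
    have h12 : Integrable (fun x => (S x - p * m) ^ 2 / (2 * p * δ) +
      ∑ i, (lik b (x i) - f (x i))) γ := hi1.add hi2
    simp only [hG]
    rw [integral_add h12 (integrable_const _), integral_add hi1 hi2,
      integral_div, integral_finsetSum _ (fun i _ => hri i)]
    have : ∀ i : Fin p, ∫ x : Fin p → ℝ, (lik b (x i) - f (x i)) ∂γ =
        ∫ y, (lik b y - f y) ∂g := fun i =>
      integral_comp_eval (μ := fun _ : Fin p => g) (f := fun y => lik b y - f y)
        (hLi.sub hfi).aestronglyMeasurable
    simp_rw [this]
    have h1 : (∫ x, (S x - p * m) ^ 2 ∂γ) / (2 * p * δ) ≤ p * δ / 2 := by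
      rw [div_le_iff₀ (by positivity)]
      calc _ ≤ _ := hvar
        _ = _ := by ring
    have h2 := mul_le_mul_of_nonneg_left hfe hp0.le
    have h3 := mul_le_mul_of_nonneg_left hm1 hp0.le
    simp only [Finset.sum_const, Finset.card_univ, Fintype.card_fin, nsmul_eq_mul, integral_const,
      probReal_univ, smul_eq_mul, one_mul]
    linarith
  have hpt : ∀ x, ‖∑ i, (lik b (x i) * T x - T x)‖ ≤ G x := by
    intro x
    have e1 : ∑ i, (lik b (x i) * T x - T x) = (∑ i, (lik b (x i) - 1)) * T x := by
      rw [Finset.sum_mul]; exact Finset.sum_congr rfl fun i _ => by ring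
    have e2 : ∑ i, (lik b (x i) - 1) =
        (S x - p * m) + ∑ i, (lik b (x i) - f (x i)) - p * (1 - m) := by
      rw [hSx, Finset.sum_sub_distrib, Finset.sum_sub_distrib]; simp; ring
    have h0 : 0 ≤ ∑ i, (lik b (x i) - f (x i)) :=
      Finset.sum_nonneg fun i _ => sub_nonneg.2 (hfL _)
    have h1 : |S x - p * m| ≤ (S x - p * m) ^ 2 / (2 * p * δ) + p * δ / 2 := by
      rw [← sub_le_iff_le_add, le_div_iff₀ (by positivity)]
      nlinarith [sq_nonneg (|S x - p * m| - p * δ), sq_abs (S x - p * m)]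
    have h2 : 0 ≤ p * (1 - m) := by positivity
    rw [e1, norm_mul, Real.norm_of_nonneg (hT.2.1 x).1]
    refine (mul_le_of_le_one_right (norm_nonneg _) (hT.2.1 x).2).trans ?_
    rw [e2, Real.norm_eq_abs, hG]
    have h4 := abs_le.1 (le_refl |S x - p * m|)
    simp only
    rw [abs_le]
    constructor <;> linarith [h4.1, h4.2]
  have hfin := (norm_integral_le_of_norm_le hGi (ae_of_all _ hpt)).trans hGint
  rw [← hmain, Real.norm_eq_abs, abs_mul, abs_of_pos hp0] at hfin
  rw [eγ]
  exact le_of_mul_le_mul_left hfin hp0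

/-- If `√(2 log p) − ν_p → ∞`, then
`sup_{T ∈ 𝒯_p, β ∈ B_p(ν_p)} |Power(T, β) − Level(T)| → 0`:
no permutation-invariant test can distinguish `N(0, I_p)` from one-spike alternatives with
spike of size at most `ν_p`. -/
theorem stmt11 (ν : ℕ → ℝ) (hν : ∀ p, 0 < ν p)
    (hgap : Tendsto (fun p : ℕ => Real.sqrt (2 * Real.log p) - ν p) atTop atTop) :
    Tendsto
      (fun p : ℕ =>
        ⨆ q : {q : ((Fin p → ℝ) → ℝ) × (Fin p → ℝ) //
            IsPermInvariantTest p q.1 ∧ q.2 ∈ oneSpikeSet p (ν p)},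
          |(∫ x, q.1.1 x ∂(gaussianPi p q.1.2)) - ∫ x, q.1.1 x ∂(gaussianPi p 0)|)
      atTop (nhds 0) := by
  have hlim : Tendsto (fun p : ℕ => Real.exp (-(Real.sqrt (2 * Real.log p) - ν p) ^ 2 / 8) +
        2 * Real.exp (-(Real.sqrt (2 * Real.log p) - ν p) ^ 2 / 2)) atTop (nhds 0) := by
    have hsq := (tendsto_pow_atTop (two_ne_zero)).comp hgap
    have h : ∀ c : ℝ, 0 < c → Tendsto (fun p : ℕ =>
        Real.exp (-(Real.sqrt (2 * Real.log p) - ν p) ^ 2 / c)) atTop (nhds 0) := by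
      intro c hc
      have := Real.tendsto_exp_neg_atTop_nhds_zero.comp (hsq.atTop_div_const hc)
      refine this.congr fun p => ?_
      simp only [Function.comp]
      ring_nf
    simpa using (h 8 (by norm_num)).add ((h 2 (by norm_num)).const_mul 2)
  refine tendsto_of_tendsto_of_tendsto_of_le_of_le' tendsto_const_nhds hlim
    (Eventually.of_forall fun p => Real.iSup_nonneg fun q => abs_nonneg _) ?_
  filter_upwards [hgap.eventually_ge_atTop 0, eventually_gt_atTop 0] with p h1 h2
  refine Real.iSup_le (fun q => ?_) (by positivity)
  exact main_bound p h2 (ν p) (by linarith) _ q.2.1 _ q.2.2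
end
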